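/- The linear automorphism κ of F³ given by (y₀, y₁, y₂) ↦ (y₀ + y₂, y₁, y₂) induces a collineation of PG(2,3) that fixes every point of the line t = { [v] : v₂ = 0 } and fixes every line through P₀ := [(1,0,0)] (as a set), and it maps Δ_j onto Δ_{j+1} for every j ∈ F, where Δ_j := { [(u²+j, u, 1)] : u ∈ F }. Moreover it is unique with these properties: any g ∈ GL(3, F) whose induced collineation fixes every point of t, fixes every line through P₀, and maps Δ₀ onto Δ₁ induces the same collineation as κ. -/

import Mathlib

/-- `F = GF(3)` realized as `ZMod 3`. -/
abbrev F3 := ZMod 3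

/-- `PG(2,3)`: the projective space of `F³`. -/
abbrev PG2 := Projectivization F3 (Fin 3 → F3)

/-- `v` is a representative vector of the projective point `X ∈ PG(2,3)`. -/
def IsRep3 (v : Fin 3 → F3) (X : PG2) : Prop :=
  ∃ hv : v ≠ 0, Projectivization.mk F3 v hv = X

/-- A line of `PG(2,3)`: the set of projective points of a 2-dimensional subspace of `F³`. -/
def IsLine2 (L : Set PG2) : Prop :=
  ∃ W : Submodule F3 (Fin 3 → F3), Module.finrank F3 W = 2 ∧
    L = {X | ∃ v, IsRep3 v X ∧ v ∈ W}

/-- A conic in `PG(2,3)`: the set of projective zeros of a quadratic form `q` on `F³`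
whose polar bilinear form `B(x,y) = q(x+y) − q(x) − q(y)` is nondegenerate. -/
def IsConic2 (C : Set PG2) : Prop :=
  ∃ q : QuadraticForm F3 (Fin 3 → F3),
    (∀ x : Fin 3 → F3, (∀ y, q (x + y) - q x - q y = 0) → x = 0) ∧
    C = {X | ∀ v, IsRep3 v X → q v = 0}

/-- A line is a tangent of a conic `C` if it meets `C` in exactly one point. -/
def IsTangent2 (L C : Set PG2) : Prop :=
  IsLine2 L ∧ (L ∩ C).ncard = 1

/-- A point of `PG(2,3)` is an internal point of `C` if it lies on no tangent of `C`. -/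
def IsInternal2 (X : PG2) (C : Set PG2) : Prop :=
  ∀ L : Set PG2, IsTangent2 L C → X ∉ L

/-- For `j ∈ F` the set `Δ_j := { [(u²+j, u, 1)] : u ∈ F } ⊆ PG(2,3)`. -/
def Δ2 (j : F3) : Set PG2 :=
  {X | ∃ u : F3, IsRep3 ![u ^ 2 + j, u, 1] X}

/-- The point `P₀ = [(1,0,0)]`. -/
def P₀ : PG2 := Projectivization.mk F3 ![1, 0, 0] (by decide)

/-- The linear automorphism `κ` of `F³` given by `(y₀, y₁, y₂) ↦ (y₀ + y₂, y₁, y₂)`. -/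
def κ : (Fin 3 → F3) ≃ₗ[F3] (Fin 3 → F3) :=
  LinearEquiv.ofLinear
    (Matrix.toLin' !![1, 0, 1; 0, 1, 0; 0, 0, 1])
    (Matrix.toLin' !![1, 0, 2; 0, 1, 0; 0, 0, 1])
    (by
      rw [← Matrix.toLin'_mul,
        show (!![1, 0, 1; 0, 1, 0; 0, 0, 1] : Matrix (Fin 3) (Fin 3) F3) *
          !![1, 0, 2; 0, 1, 0; 0, 0, 1] = 1 by decide, Matrix.toLin'_one])
    (by
      rw [← Matrix.toLin'_mul,
        show (!![1, 0, 2; 0, 1, 0; 0, 0, 1] : Matrix (Fin 3) (Fin 3) F3) *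
          !![1, 0, 1; 0, 1, 0; 0, 0, 1] = 1 by decide, Matrix.toLin'_one])

/-- The collineation of `PG(2,3)` induced by `κ`. -/
noncomputable def mapκ : PG2 → PG2 :=
  Projectivization.map κ.toLinearMap (κ.injective)

/-- The collineation of `PG(2,3)` induced by `g ∈ GL(3, F)`. -/
noncomputable def mapOf (g : (Fin 3 → F3) ≃ₗ[F3] (Fin 3 → F3)) : PG2 → PG2 :=
  Projectivization.map g.toLinearMap (g.injective)

theorem κ_apply (v : Fin 3 → F3) : κ v = ![v 0 + v 2, v 1, v 2] := by
  ext i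
  fin_cases i <;> simp [κ, Matrix.mulVec, dotProduct, Fin.sum_univ_three]

theorem κ_apply_eq_add_smul (v : Fin 3 → F3) : κ v = v + v 2 • ![1, 0, 0] := by
  rw [κ_apply]
  ext i
  fin_cases i <;> simp

theorem IsRep3.exists_smul_eq {v w : Fin 3 → F3} {X : PG2} (hv : IsRep3 v X) (hw : IsRep3 w X) :
    ∃ a : F3, a • w = v := by
  obtain ⟨hv, rfl⟩ := hv
  obtain ⟨hw, h⟩ := hw
  exact (Projectivization.mk_eq_mk_iff' F3 v w hv hw).1 h.symm

theorem IsRep3.eq {v : Fin 3 → F3} {X Y : PG2} (hX : IsRep3 v X) (hY : IsRep3 v Y) : X = Y := by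
  obtain ⟨_, rfl⟩ := hX
  exact hY.2

theorem IsRep3.mapOf {v : Fin 3 → F3} {X : PG2} (hv : IsRep3 v X)
    (g : (Fin 3 → F3) ≃ₗ[F3] (Fin 3 → F3)) : IsRep3 (g v) (mapOf g X) := by
  obtain ⟨hv, rfl⟩ := hv
  exact ⟨g.map_ne_zero_iff.2 hv, rfl⟩

theorem IsRep3.mapκ {v : Fin 3 → F3} {X : PG2} (hv : IsRep3 v X) : IsRep3 (κ v) (mapκ X) :=
  hv.mapOf κ

theorem isRep3_P₀ : IsRep3 ![1, 0, 0] P₀ := ⟨by decide, rfl⟩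

theorem mapκ_eq_self {X : PG2} {v : Fin 3 → F3} (hv : IsRep3 v X) (h : v 2 = 0) :
    mapκ X = X := by
  refine hv.mapκ.eq ?_
  rwa [κ_apply_eq_add_smul, h, zero_smul, add_zero]

theorem mapκ_image_line {L : Set PG2} (hL : IsLine2 L) (hP : P₀ ∈ L) : mapκ '' L = L := by
  obtain ⟨W, -, rfl⟩ := hL
  obtain ⟨p, hp, hpW⟩ := hP
  have he : (![1, 0, 0] : Fin 3 → F3) ∈ W := by
    obtain ⟨a, ha⟩ := isRep3_P₀.exists_smul_eq hp
    exact ha ▸ W.smul_mem a hpW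
  have hκ (v : Fin 3 → F3) : κ v ∈ W ↔ v ∈ W := by
    rw [κ_apply_eq_add_smul]
    exact W.add_mem_iff_left (W.smul_mem _ he)
  ext Y
  constructor
  · rintro ⟨X, ⟨v, hv, hvW⟩, rfl⟩
    exact ⟨κ v, hv.mapκ, (hκ v).2 hvW⟩
  · rintro ⟨v, hv, hvW⟩
    have hr : IsRep3 (κ.symm v) (Projectivization.mk F3 _ (κ.symm.map_ne_zero_iff.2 hv.1)) :=
      ⟨_, rfl⟩
    refine ⟨_, ⟨κ.symm v, hr, (hκ _).1 (by simpa using hvW)⟩, hr.mapκ.eq ?_⟩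
    simpa using hv

theorem mapκ_image_Δ2 (j : F3) : mapκ '' Δ2 j = Δ2 (j + 1) := by
  have hκ (u : F3) : κ ![u ^ 2 + j, u, 1] = ![u ^ 2 + (j + 1), u, 1] := by
    simp [κ_apply, add_assoc]
  ext Y
  constructor
  · rintro ⟨X, ⟨u, hu⟩, rfl⟩
    exact ⟨u, hκ u ▸ hu.mapκ⟩
  · rintro ⟨u, hu⟩
    have hr : IsRep3 ![u ^ 2 + j, u, 1]
        (Projectivization.mk F3 ![u ^ 2 + j, u, 1] fun h => one_ne_zero (congrFun h 2)) :=
      ⟨_, rfl⟩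
    exact ⟨_, ⟨u, hr⟩, hr.mapκ.eq (hκ u ▸ hu)⟩

theorem exists_smul_of_fixes_axis {g : (Fin 3 → F3) ≃ₗ[F3] (Fin 3 → F3)}
    (hg : ∀ (X : PG2) (v : Fin 3 → F3), IsRep3 v X → v 2 = 0 → mapOf g X = X) :
    ∃ c : F3, c ≠ 0 ∧ g ![1, 0, 0] = c • ![1, 0, 0] ∧ g ![0, 1, 0] = c • ![0, 1, 0] := by
  have key (v : Fin 3 → F3) (hv : v ≠ 0) (h : v 2 = 0) : ∃ c : F3, c • v = g v := by
    have hr : IsRep3 v (Projectivization.mk F3 v hv) := ⟨hv, rfl⟩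
    exact (hg _ v hr h ▸ hr.mapOf g).exists_smul_eq hr
  obtain ⟨a, ha⟩ := key ![1, 0, 0] (by decide) rfl
  obtain ⟨b, hb⟩ := key ![0, 1, 0] (by decide) rfl
  obtain ⟨c, hc⟩ := key ![1, 1, 0] (by decide) rfl
  have hsum : (![1, 1, 0] : Fin 3 → F3) = ![1, 0, 0] + ![0, 1, 0] := by decide
  rw [hsum, map_add, ← ha, ← hb] at hc
  have h0 : c = a := by simpa using congrFun hc 0
  have h1 : c = b := by simpa using congrFun hc 1
  subst h0 h1
  refine ⟨c, ?_, ha.symm, hb.symm⟩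
  rintro rfl
  exact g.map_ne_zero_iff.2 (by decide : (![1, 0, 0] : Fin 3 → F3) ≠ 0) (by simpa using ha.symm)

/-- An affine map `(x, y) ↦ (c x + p, c y + q) / r` taking the parabola `x = y²` into
`x = y² + 1` is the translation by `(1, 0)`. -/
theorem eq_translation_of_maps_parabola : ∀ c p q r : F3, c ≠ 0 →
    (∀ u : F3, ∃ s : F3, c * u ^ 2 + p = r * (s ^ 2 + 1) ∧ c * u + q = r * s) →
    p = c ∧ q = 0 ∧ r = c := by
  decide

theorem eq_smul_κ {g : (Fin 3 → F3) ≃ₗ[F3] (Fin 3 → F3)}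
    (hg : ∀ (X : PG2) (v : Fin 3 → F3), IsRep3 v X → v 2 = 0 → mapOf g X = X)
    (hΔ : mapOf g '' Δ2 0 = Δ2 1) : ∃ c : F3, ∀ v, g v = c • κ v := by
  obtain ⟨c, hc, h0, h1⟩ := exists_smul_of_fixes_axis hg
  have hexp (v : Fin 3 → F3) : g v =
      ![c * v 0 + v 2 * g ![0, 0, 1] 0, c * v 1 + v 2 * g ![0, 0, 1] 1,
        v 2 * g ![0, 0, 1] 2] := by
    have hv : v = v 0 • ![1, 0, 0] + v 1 • ![0, 1, 0] + v 2 • ![0, 0, 1] := by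
      ext i
      fin_cases i <;> simp
    conv_lhs => rw [hv, map_add, map_add, map_smul, map_smul, map_smul, h0, h1]
    ext i
    fin_cases i <;> simp [mul_comm]
  have hpar (u : F3) : ∃ s : F3,
      c * u ^ 2 + g ![0, 0, 1] 0 = g ![0, 0, 1] 2 * (s ^ 2 + 1) ∧
        c * u + g ![0, 0, 1] 1 = g ![0, 0, 1] 2 * s := by
    have hr : IsRep3 ![u ^ 2 + 0, u, 1]
        (Projectivization.mk F3 ![u ^ 2 + 0, u, 1] fun h => one_ne_zero (congrFun h 2)) :=
      ⟨_, rfl⟩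
    obtain ⟨s, hs⟩ := hΔ ▸ Set.mem_image_of_mem (mapOf g) (⟨u, hr⟩ : _ ∈ Δ2 0)
    obtain ⟨k, hk⟩ := (hr.mapOf g).exists_smul_eq hs
    rw [hexp] at hk
    have k0 := congrFun hk 0
    have k1 := congrFun hk 1
    have k2 := congrFun hk 2
    simp at k0 k1 k2
    subst k2
    exact ⟨s, k0.symm, k1.symm⟩
  obtain ⟨hp, hq, hr⟩ := eq_translation_of_maps_parabola _ _ _ _ hc hpar
  refine ⟨c, fun v => ?_⟩
  rw [hexp, hp, hq, hr, κ_apply]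
  ext i
  fin_cases i <;> simp [mul_add, mul_comm]

/-- The linear automorphism `κ : (y₀,y₁,y₂) ↦ (y₀+y₂, y₁, y₂)` induces a
collineation of `PG(2,3)` that fixes every point of the line `t = {[v] : v₂ = 0}`,
fixes (as a set) every line through `P₀ = [(1,0,0)]`, and maps `Δ_j` onto `Δ_{j+1}`
for every `j ∈ F`. Moreover, any `g ∈ GL(3,F)` with these properties (for `Δ₀ ↦ Δ₁`)
induces the same collineation as `κ`. -/
theorem kappa_elation_properties_and_uniqueness :
    (∀ v : Fin 3 → F3, κ v = ![v 0 + v 2, v 1, v 2]) ∧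
    (∀ (X : PG2) (v : Fin 3 → F3), IsRep3 v X → v 2 = 0 → mapκ X = X) ∧
    (∀ L : Set PG2, IsLine2 L → P₀ ∈ L → mapκ '' L = L) ∧
    (∀ j : F3, mapκ '' Δ2 j = Δ2 (j + 1)) ∧
    (∀ g : (Fin 3 → F3) ≃ₗ[F3] (Fin 3 → F3),
      (∀ (X : PG2) (v : Fin 3 → F3), IsRep3 v X → v 2 = 0 → mapOf g X = X) →
      (∀ L : Set PG2, IsLine2 L → P₀ ∈ L → mapOf g '' L = L) →
      mapOf g '' Δ2 0 = Δ2 1 →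
      ∀ X : PG2, mapOf g X = mapκ X) := by
  refine ⟨κ_apply, fun X v => mapκ_eq_self, fun L => mapκ_image_line, mapκ_image_Δ2, ?_⟩
  intro g hg _ hΔ X
  obtain ⟨c, hgκ⟩ := eq_smul_κ hg hΔ
  induction X using Projectivization.ind with
  | h v hv => exact (Projectivization.mk_eq_mk_iff' F3 _ _ _ _).2 ⟨c, (hgκ v).symm⟩
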